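/- Let (Bun, T) be a dynamical system doctrine: Bun : 𝒞ᵒᵖ ⥤ Cat a strict indexed category and T a section of the projection π : ∫Bun ⥤ 𝒞. Let ⟨f♯, f⟩ : ⟨I,O⟩ ⇆ ⟨I',O'⟩ be a lens (f : O ⟶ O', f♯ : f*I' ⟶ I in Bun(O)). For a (Bun,T)-dynamical system (S, r, u) with interface ⟨I,O⟩, define the recomposed system with interface ⟨I',O'⟩ to have the same states S, readout r ≫ f, and update u ∘ r*(f♯) ∘ ι : (r ≫ f)*I' ⟶ T₂S, where ι : (r ≫ f)*I' ⟶ r*(f*I') is the strictness identification. Then if φ : S ⟶ S' is a covariant morphism from (S,r,u) to (S',r',u') over ⟨I,O⟩, the same φ is a covariant morphism between the recomposed systems over ⟨I',O'⟩; together with the evident action on objects, this makes recomposition along ⟨f♯,f⟩ a functor Dyn⟨I,O⟩ → Dyn⟨I',O'⟩. -/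

import Mathlib

open CategoryTheory Opposite

universe w₁ w₂ v u

variable {𝒞 : Type u} [Category.{v} 𝒞] (Bun : 𝒞ᵒᵖ ⥤ Cat.{w₁, w₂})

/-- Reindexing functor `f*` of the strict indexed category `Bun`. -/
def re {C C' : 𝒞} (f : C ⟶ C') : ↥(Bun.obj (op C')) ⥤ ↥(Bun.obj (op C)) :=
  (Bun.map f.op).toFunctor

theorem re_id (C : 𝒞) : re Bun (𝟙 C) = 𝟭 (Bun.obj (op C)) := by
  simp [re]

theorem re_id_obj (C : 𝒞) (A : Bun.obj (op C)) : (re Bun (𝟙 C)).obj A = A := by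
  rw [re_id]; rfl

theorem re_comp {C C' C'' : 𝒞} (f : C ⟶ C') (g : C' ⟶ C'') :
    re Bun (f ≫ g) = re Bun g ⋙ re Bun f := by
  simp [re]

theorem re_comp_obj {C C' C'' : 𝒞} (f : C ⟶ C') (g : C' ⟶ C'')
    (A : Bun.obj (op C'')) :
    (re Bun (f ≫ g)).obj A = (re Bun f).obj ((re Bun g).obj A) := by
  rw [re_comp]; rfl

/-- A (strict) section `T` of the projection `π : ∫Bun ⥤ 𝒞`, given by its
components: `T(S) = ⟨T₂S, S⟩` on objects and `T(φ) = (φ, τφ)` on morphisms,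
together with the functoriality laws making `T : 𝒞 ⥤ ∫Bun` a functor with
`T ⋙ π = 𝟭 𝒞`. -/
structure SectionData where
  T₂ : ∀ C : 𝒞, Bun.obj (op C)
  τ : ∀ {C C' : 𝒞} (φ : C ⟶ C'), T₂ C ⟶ (re Bun φ).obj (T₂ C')
  τ_id : ∀ C : 𝒞, τ (𝟙 C) = eqToHom (re_id_obj Bun C (T₂ C)).symm
  τ_comp : ∀ {C C' C'' : 𝒞} (φ : C ⟶ C') (ψ : C' ⟶ C''),
    τ (φ ≫ ψ) = τ φ ≫ (re Bun φ).map (τ ψ) ≫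
      eqToHom (re_comp_obj Bun φ ψ (T₂ C'')).symm

variable {O : 𝒞}

/-- `φ : S ⟶ S'` is a covariant morphism from the `(Bun,T)`-dynamical system
`(S, r, u)` to `(S', r', u')` over the interface `⟨I,O⟩` when `φ ≫ r' = r` and
`τφ ∘ u = φ*(u') ∘ ι`, with `ι` the strictness identification
`r*I ⟶ φ*(r'*I)` induced by `r = φ ≫ r'`. -/
def IsCovariant (T : SectionData Bun) (I : Bun.obj (op O)) {S S' : 𝒞}
    (r : S ⟶ O) (u : (re Bun r).obj I ⟶ T.T₂ S)
    (r' : S' ⟶ O) (u' : (re Bun r').obj I ⟶ T.T₂ S')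
    (φ : S ⟶ S') : Prop :=
  ∃ h : φ ≫ r' = r,
    u ≫ T.τ φ =
      eqToHom (show (re Bun r).obj I = (re Bun φ).obj ((re Bun r').obj I) by
        rw [← h, re_comp_obj]) ≫ (re Bun φ).map u'

/-- The update of the system recomposed along the lens `⟨f♯, f⟩ : ⟨I,O⟩ ⇆ ⟨I',O'⟩`:
`u ∘ r*(f♯) ∘ ι : (r ≫ f)*I' ⟶ T₂S`, where `ι` is the strictness identification
`(r ≫ f)*I' ⟶ r*(f*I')`.  The recomposed system has states `S` and readout `r ≫ f`. -/
def recomposedUpdate (T : SectionData Bun) {O O' : 𝒞} {I : Bun.obj (op O)}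
    {I' : Bun.obj (op O')} (f : O ⟶ O') (fsharp : (re Bun f).obj I' ⟶ I)
    {S : 𝒞} (r : S ⟶ O) (u : (re Bun r).obj I ⟶ T.T₂ S) :
    (re Bun (r ≫ f)).obj I' ⟶ T.T₂ S :=
  eqToHom (re_comp_obj Bun r f I') ≫ (re Bun r).map fsharp ≫ u

/-- Reindexing a morphism along a composite agrees, up to the strictness identifications,
with reindexing it twice. -/
theorem re_comp_map {C C' C'' : 𝒞} (f : C ⟶ C') (g : C' ⟶ C'')
    {A B : Bun.obj (op C'')} (k : A ⟶ B) :
    (re Bun (f ≫ g)).map k =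
      eqToHom (re_comp_obj Bun f g A) ≫ (re Bun f).map ((re Bun g).map k) ≫
        eqToHom (re_comp_obj Bun f g B).symm :=
  Functor.congr_hom (re_comp Bun f g) k

/-!
STATEMENT 9: Recomposition along a lens `⟨f♯, f⟩ : ⟨I,O⟩ ⇆ ⟨I',O'⟩` sends covariant
morphisms over `⟨I,O⟩` to covariant morphisms over `⟨I',O'⟩`; together with the
evident action on objects this makes recomposition a functor
`Dyn⟨I,O⟩ → Dyn⟨I',O'⟩`.
-/

theorem recomposition_along_a_lens_is_functorial
    (T : SectionData Bun) {O' : 𝒞} (I : Bun.obj (op O)) (I' : Bun.obj (op O'))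
    (f : O ⟶ O') (fsharp : (re Bun f).obj I' ⟶ I)
    {S S' : 𝒞}
    (r : S ⟶ O) (u : (re Bun r).obj I ⟶ T.T₂ S)
    (r' : S' ⟶ O) (u' : (re Bun r').obj I ⟶ T.T₂ S')
    (φ : S ⟶ S')
    (hφ : IsCovariant Bun T I r u r' u' φ) :
    IsCovariant Bun T I' (r ≫ f) (recomposedUpdate Bun T f fsharp r u)
      (r' ≫ f) (recomposedUpdate Bun T f fsharp r' u') φ := by
  obtain ⟨rfl, hu⟩ := hφ
  refine ⟨(Category.assoc _ _ _).symm, ?_⟩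
  simp only [recomposedUpdate, Category.assoc, hu, re_comp_map, Functor.map_comp,
    eqToHom_map, eqToHom_trans_assoc, eqToHom_refl, Category.id_comp]
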